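/- Let A be a circular matrix of order m×n without dominating rows and α ∈ ℕ. Let Γ be a simple directed circuit in F(A) with s row arcs and winding number p, satisfying p ≥ 2 and 2 ≤ p ≤ αs − 1 with p not dividing αs. Set r := αs − p·⌊αs/p⌋. Then the Γ-inequality for Q*(A, α·1) takes the form r·Σ_{j ∉ ⊗(Γ)} x_j + (r+1)·Σ_{j ∈ ⊗(Γ)} x_j ≥ r·⌈αs/p⌉. Moreover, if α = 1 and ⊗(Γ) ≠ ∅, this inequality equals the row family inequality induced by F := {i ∈ [m] : a_i is a row arc of Γ}. -/

import Mathlib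

namespace CircCover

attribute [local instance] Classical.propDecidable

/-- Membership in the circular interval `[a, a + k)ₙ` of `ZMod n`. -/
def inInterval {n : ℕ} (a : ZMod n) (k : ℕ) (j : ZMod n) : Prop :=
  ∃ s : ℕ, s < k ∧ j = a + (s : ZMod n)

/-- The `{0,1}`-matrix whose `i`-th row is the incidence vector of `[ℓ i, ℓ i + k i)ₙ`. -/
noncomputable def circMatrix {m n : ℕ} (ℓ : Fin m → ZMod n) (k : Fin m → ℕ) :
    Matrix (Fin m) (ZMod n) ℝ :=
  fun i j => if inInterval (ℓ i) (k i) j then 1 else 0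

/-- The condition `2 ≤ kᵢ ≤ n - 1` making `circMatrix ℓ k` a circular matrix. -/
def circBounds (n : ℕ) {m : ℕ} (k : Fin m → ℕ) : Prop :=
  ∀ i, 2 ≤ k i ∧ k i ≤ n - 1

/-- Arcs of the digraph `D(A)` associated with a circular matrix. -/
inductive Arc (m n : ℕ) : Type
  | fwdRow (i : Fin m)
  | fwdShort (j : ZMod n)
  | revRow (i : Fin m)
  | revShort (j : ZMod n)
  deriving DecidableEq

namespace Arc

variable {m n : ℕ} (ℓ : Fin m → ZMod n) (k : Fin m → ℕ)

/-- The tail of an arc of `D(A)`. -/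
def tail : Arc m n → ZMod n
  | fwdRow i => ℓ i - 1
  | fwdShort j => j - 1
  | revRow i => ℓ i + (k i : ZMod n) - 1
  | revShort j => j

/-- The head of an arc of `D(A)`. -/
def head : Arc m n → ZMod n
  | fwdRow i => ℓ i + (k i : ZMod n) - 1
  | fwdShort j => j
  | revRow i => ℓ i - 1
  | revShort j => j - 1

/-- The oriented length of an arc of `D(A)`. -/
def len (k : Fin m → ℕ) : Arc m n → ℤ
  | fwdRow i => (k i : ℤ)
  | fwdShort _ => 1
  | revRow i => -(k i : ℤ)
  | revShort _ => -1

/-- Forward arcs. -/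
def IsForward : Arc m n → Prop
  | fwdRow _ => True
  | fwdShort _ => True
  | _ => False

/-- Forward row arcs. -/
def IsFwdRow : Arc m n → Prop
  | fwdRow _ => True
  | _ => False

/-- Reverse row arcs. -/
def IsRevRow : Arc m n → Prop
  | revRow _ => True
  | _ => False

/-- Forward short arcs. -/
def IsFwdShort : Arc m n → Prop
  | fwdShort _ => True
  | _ => False

/-- The arc jumps over node `j`. -/
def Jumps : Arc m n → ZMod n → Prop
  | fwdRow i, j => inInterval (ℓ i) (k i) j
  | fwdShort j', j => j' = j
  | revRow i, j => inInterval (ℓ i) (k i) j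
  | revShort j', j => j' = j

end Arc

variable {m n : ℕ}

/-- A (not necessarily simple) closed directed path in `D(A)`, given as its list of arcs. -/
def IsClosedWalk (ℓ : Fin m → ZMod n) (k : Fin m → ℕ) (γ : List (Arc m n)) : Prop :=
  ∃ h : γ ≠ [],
    List.Chain' (fun a b => Arc.head ℓ k a = Arc.tail ℓ k b) γ ∧
      Arc.head ℓ k (γ.getLast h) = Arc.tail ℓ k (γ.head h)

/-- A simple directed circuit in `D(A)`: a closed directed path visiting pairwise
distinct nodes. -/
def IsCircuit (ℓ : Fin m → ZMod n) (k : Fin m → ℕ) (γ : List (Arc m n)) : Prop :=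
  IsClosedWalk ℓ k γ ∧ (γ.map (Arc.tail ℓ k)).Nodup

/-- The sum of the oriented lengths of the arcs of `γ`; it equals `p(γ) * n` where `p(γ)`
is the winding number. -/
def windingSum (k : Fin m → ℕ) (γ : List (Arc m n)) : ℤ :=
  (γ.map (Arc.len k)).sum

/-- `p⁺(γ, j)`: the number of forward arcs of `γ` jumping over `j`. -/
noncomputable def pPlus (ℓ : Fin m → ZMod n) (k : Fin m → ℕ) (γ : List (Arc m n))
    (j : ZMod n) : ℕ :=
  γ.countP fun a => decide (Arc.IsForward a ∧ Arc.Jumps ℓ k a j)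

/-- `p⁻(γ, j)`: the number of reverse arcs of `γ` jumping over `j`. -/
noncomputable def pMinus (ℓ : Fin m → ZMod n) (k : Fin m → ℕ) (γ : List (Arc m n))
    (j : ZMod n) : ℕ :=
  γ.countP fun a => decide (¬ Arc.IsForward a ∧ Arc.Jumps ℓ k a j)

/-- The number of (forward) row arcs of `γ` jumping over `j`. -/
noncomputable def rowJumpCount (ℓ : Fin m → ZMod n) (k : Fin m → ℕ) (γ : List (Arc m n))
    (j : ZMod n) : ℕ :=
  γ.countP fun a => decide (Arc.IsFwdRow a ∧ Arc.Jumps ℓ k a j)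

/-- The number of forward row arcs of `γ`. -/
def numRowArcs (γ : List (Arc m n)) : ℕ :=
  γ.countP fun a => match a with | Arc.fwdRow _ => true | _ => false

/-- `t(γ, b) = ∑_{aᵢ ∈ γ} bᵢ - ∑_{āᵢ ∈ γ} bᵢ`. -/
def tVal (b : Fin m → ℤ) (γ : List (Arc m n)) : ℤ :=
  (γ.map fun a => match a with
    | Arc.fwdRow i => b i
    | Arc.revRow i => -(b i)
    | _ => 0).sum

/-- `t⁻(γ, b) = ∑_{āᵢ ∈ γ} bᵢ`. -/
def tMinusVal (b : Fin m → ℤ) (γ : List (Arc m n)) : ℤ :=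
  (γ.map fun a => match a with
    | Arc.revRow i => b i
    | _ => 0).sum

/-- `β(γ, b) = ⌊t(γ, b) / p⌋`. -/
def betaVal (b : Fin m → ℤ) (γ : List (Arc m n)) (p : ℤ) : ℤ :=
  Int.fdiv (tVal b γ) p

/-- `r(γ, b) = t(γ, b) - β(γ, b) * p`. -/
def rVal (b : Fin m → ℤ) (γ : List (Arc m n)) (p : ℤ) : ℤ :=
  tVal b γ - betaVal b γ p * p

/-- The `γ`-inequality `∑ⱼ (p⁻(γ,j) + r) xⱼ ≥ r (β + 1) + ∑_{āᵢ ∈ γ} bᵢ`. -/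
def GammaIneqHolds [NeZero n] (ℓ : Fin m → ZMod n) (k : Fin m → ℕ) (b : Fin m → ℤ)
    (γ : List (Arc m n)) (p : ℤ) (x : ZMod n → ℝ) : Prop :=
  ∑ j : ZMod n, ((pMinus ℓ k γ j : ℝ) + (rVal b γ p : ℝ)) * x j ≥
    (rVal b γ p : ℝ) * ((betaVal b γ p : ℝ) + 1) + (tMinusVal b γ : ℝ)

/-- The fractional covering polyhedron `Q(A, b) = {x ≥ 0 : A x ≥ b}`. -/
def Qpoly [NeZero n] (A : Matrix (Fin m) (ZMod n) ℝ) (b : Fin m → ℝ) :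
    Set (ZMod n → ℝ) :=
  {x | (∀ j, 0 ≤ x j) ∧ ∀ i, b i ≤ ∑ j : ZMod n, A i j * x j}

/-- A point of `ℝⁿ` all whose coordinates are integers. -/
def IsIntegerPoint {n : ℕ} (x : ZMod n → ℝ) : Prop :=
  ∀ j, ∃ z : ℤ, x j = (z : ℝ)

/-- The covering polyhedron `Q*(A, b) = conv{x ∈ ℤⁿ : x ≥ 0, A x ≥ b}`. -/
noncomputable def Qstar [NeZero n] (A : Matrix (Fin m) (ZMod n) ℝ) (b : Fin m → ℝ) :
    Set (ZMod n → ℝ) :=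
  convexHull ℝ {x | IsIntegerPoint x ∧ x ∈ Qpoly A b}

/-- The slack of row `i` of `A` at the point `x`. -/
noncomputable def rowSlack [NeZero n] (ℓ : Fin m → ZMod n) (k : Fin m → ℕ)
    (b : Fin m → ℤ) (x : ZMod n → ℝ) (i : Fin m) : ℝ :=
  (∑ j : ZMod n, circMatrix ℓ k i j * x j) - (b i : ℝ)

/-- `μ = ⌈1ᵀ x⌉ - 1ᵀ x`. -/
noncomputable def muVal [NeZero n] (x : ZMod n → ℝ) : ℝ :=
  (⌈∑ j : ZMod n, x j⌉ : ℝ) - ∑ j : ZMod n, x j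

/-- Entry `i` of the last column `v` of `Ã` (the column indexed by `n ≡ 0`). -/
noncomputable def vRow (ℓ : Fin m → ZMod n) (k : Fin m → ℕ) (i : Fin m) : ℝ :=
  circMatrix ℓ k i 0

/-- Entry `m + j` of the last column `v` of `Ã`. -/
noncomputable def vShort (j : ZMod n) : ℝ :=
  if j = 0 then 1 else 0

/-- The cost of an arc in the weighted digraph `D(A, x)`: forward arcs carry the cost
`c⁺ = μ (s* - (1 - μ) v)` and reverse arcs the cost `c⁻ = (1 - μ)(s* + μ v)`. -/
noncomputable def arcCost [NeZero n] (ℓ : Fin m → ZMod n) (k : Fin m → ℕ)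
    (b : Fin m → ℤ) (x : ZMod n → ℝ) : Arc m n → ℝ
  | Arc.fwdRow i => muVal x * (rowSlack ℓ k b x i - (1 - muVal x) * vRow ℓ k i)
  | Arc.fwdShort j => muVal x * (x j - (1 - muVal x) * vShort j)
  | Arc.revRow i => (1 - muVal x) * (rowSlack ℓ k b x i + muVal x * vRow ℓ k i)
  | Arc.revShort j => (1 - muVal x) * (x j + muVal x * vShort j)

/-- The cost `c(γ, x)` of a walk `γ` in `D(A, x)`. -/
noncomputable def walkCost [NeZero n] (ℓ : Fin m → ZMod n) (k : Fin m → ℕ)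
    (b : Fin m → ℤ) (x : ZMod n → ℝ) (γ : List (Arc m n)) : ℝ :=
  (γ.map (arcCost ℓ k b x)).sum

/-- Row `i` dominates row `i'` of `A`. -/
def Dominates (A : Matrix (Fin m) (ZMod n) ℝ) (i i' : Fin m) : Prop :=
  i ≠ i' ∧ ∀ j, A i' j ≤ A i j

/-- `A` has no dominating rows. -/
def NoDominatingRows (A : Matrix (Fin m) (ZMod n) ℝ) : Prop :=
  ∀ i i', ¬ Dominates A i i'

/-- The affine dimension of a subset of `ℝⁿ` (`-1` for the empty set). -/
noncomputable def adim [NeZero n] (S : Set (ZMod n → ℝ)) : ℤ :=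
  if S = ∅ then -1 else (Module.finrank ℝ (affineSpan ℝ S).direction : ℤ)

/-- The valid inequality `aᵀ x ≥ α₀` defines a facet of `P`:
the face it defines has affine dimension `dim P - 1`. -/
def IsFacetIneq [NeZero n] (P : Set (ZMod n → ℝ)) (a : ZMod n → ℝ) (α₀ : ℝ) : Prop :=
  (∀ x ∈ P, α₀ ≤ ∑ j : ZMod n, a j * x j) ∧
    adim {x ∈ P | ∑ j : ZMod n, a j * x j = α₀} = adim P - 1

/-- `j` is a node of the walk `γ`. -/
def IsNodeOf (ℓ : Fin m → ZMod n) (k : Fin m → ℕ) (γ : List (Arc m n)) (j : ZMod n) : Prop :=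
  ∃ a ∈ γ, Arc.tail ℓ k a = j

/-- `j` is an essential bullet of `γ`: a node of `γ` which is neither a circle
(head of a forward short arc of `γ`) nor a cross (tail of a reverse short arc of `γ`). -/
def IsEssentialBullet (ℓ : Fin m → ZMod n) (k : Fin m → ℕ) (γ : List (Arc m n))
    (j : ZMod n) : Prop :=
  IsNodeOf ℓ k γ j ∧ Arc.fwdShort j ∉ γ ∧ Arc.revShort j ∉ γ

/-- The number of essential bullets of `γ`. -/
noncomputable def numEssentialBullets [NeZero n] (ℓ : Fin m → ZMod n) (k : Fin m → ℕ)
    (γ : List (Arc m n)) : ℕ :=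
  (Finset.univ.filter fun j : ZMod n => IsEssentialBullet ℓ k γ j).card

/-- `∑_{i ∈ F} a_{ij}`, the number of rows of `F` whose interval contains `j`. -/
noncomputable def rowCount (ℓ : Fin m → ZMod n) (k : Fin m → ℕ) (F : Finset (Fin m))
    (j : ZMod n) : ℕ :=
  (F.filter fun i => inInterval (ℓ i) (k i) j).card

/-- The row family inequality induced by `F` (with `p* = max_j ∑_{i ∈ F} a_{ij} - 1`). -/
def RowFamilyIneqHolds [NeZero n] (ℓ : Fin m → ZMod n) (k : Fin m → ℕ)
    (F : Finset (Fin m)) (x : ZMod n → ℝ) : Prop :=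
  let s := F.card
  let pstar := (Finset.univ.sup fun j : ZMod n => rowCount ℓ k F j) - 1
  let rstar := s - pstar * (s / pstar)
  ((rstar : ℝ) + 1) * ∑ j ∈ Finset.univ.filter (fun j : ZMod n => rowCount ℓ k F j = pstar + 1), x j
    + (rstar : ℝ) * ∑ j ∈ Finset.univ.filter (fun j : ZMod n => rowCount ℓ k F j ≤ pstar), x j
    ≥ (rstar : ℝ) * (((s + pstar - 1) / pstar : ℕ) : ℝ)

section Circuits

/-- The indicator of a circular interval of length at most `n`, summed over its elements. -/
theorem ite_inInterval_eq_sum (a : ZMod n) {k : ℕ} (hk : k ≤ n) (j : ZMod n) :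
    (if inInterval a k j then (1 : ℤ) else 0) =
      ∑ s ∈ Finset.range k, if j = a + (s : ZMod n) then (1 : ℤ) else 0 := by
  split_ifs with h
  · obtain ⟨s, hs, rfl⟩ := h
    rw [Finset.sum_eq_single s]
    · simp
    · intro t ht hts
      rw [if_neg]
      intro h
      have h' := (ZMod.natCast_eq_natCast_iff' _ _ _).1 (add_left_cancel h)
      rw [Finset.mem_range] at ht
      rw [Nat.mod_eq_of_lt (by omega), Nat.mod_eq_of_lt (by omega)] at h'
      exact hts h'.symm
    · intro h
      exact absurd (Finset.mem_range.2 hs) h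
  · refine (Finset.sum_eq_zero fun s hs => if_neg fun e => h ⟨s, Finset.mem_range.1 hs, e⟩).symm

/-- The net contribution of an arc to the flow across the cut between `j - 1` and `j`. -/
noncomputable def Arc.crossing (ℓ : Fin m → ZMod n) (k : Fin m → ℕ) (j : ZMod n) (a : Arc m n) :
    ℤ :=
  if Arc.Jumps ℓ k a j then (if Arc.IsForward a then 1 else -1) else 0

theorem Arc.crossing_fwdRow (ℓ : Fin m → ZMod n) (k : Fin m → ℕ) (j : ZMod n) (i : Fin m) :
    (fwdRow i).crossing ℓ k j = if inInterval (ℓ i) (k i) j then 1 else 0 := by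
  by_cases h : inInterval (ℓ i) (k i) j <;> simp [crossing, Jumps, IsForward, h]

theorem Arc.crossing_revRow (ℓ : Fin m → ZMod n) (k : Fin m → ℕ) (j : ZMod n) (i : Fin m) :
    (revRow i).crossing ℓ k j = -if inInterval (ℓ i) (k i) j then 1 else 0 := by
  by_cases h : inInterval (ℓ i) (k i) j <;> simp [crossing, Jumps, IsForward, h]

theorem Arc.crossing_fwdShort (ℓ : Fin m → ZMod n) (k : Fin m → ℕ) (j i : ZMod n) :
    (fwdShort i).crossing ℓ k j = if i = j then 1 else 0 := by
  by_cases h : i = j <;> simp [crossing, Jumps, IsForward, h]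

theorem Arc.crossing_revShort (ℓ : Fin m → ZMod n) (k : Fin m → ℕ) (j i : ZMod n) :
    (revShort i).crossing ℓ k j = -if i = j then 1 else 0 := by
  by_cases h : i = j <;> simp [crossing, Jumps, IsForward, h]

theorem Arc.crossing_add_one_sub (ℓ : Fin m → ZMod n) (k : Fin m → ℕ) (hk : ∀ i, k i ≤ n)
    (j : ZMod n) (a : Arc m n) :
    a.crossing ℓ k (j + 1) - a.crossing ℓ k j =
      (if a.tail ℓ k = j then 1 else 0) - (if a.head ℓ k = j then 1 else 0) := by
  have row (i : Fin m) : (if inInterval (ℓ i) (k i) (j + 1) then (1 : ℤ) else 0) -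
      (if inInterval (ℓ i) (k i) j then (1 : ℤ) else 0) =
      (if ℓ i - 1 = j then 1 else 0) - (if ℓ i + (k i : ZMod n) - 1 = j then 1 else 0) := by
    rw [ite_inInterval_eq_sum _ (hk i), ite_inInterval_eq_sum _ (hk i), ← Finset.sum_sub_distrib]
    have := Finset.sum_range_sub' (fun s : ℕ => if j + 1 = ℓ i + (s : ZMod n) then (1 : ℤ) else 0)
      (k i)
    simp only [Nat.cast_add, Nat.cast_one, ← add_assoc, add_left_inj, Nat.cast_zero, add_zero]
      at this
    rw [this]
    simp only [sub_eq_iff_eq_add (c := j), eq_comm (a := j + 1)]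
  have short (i : ZMod n) : (if i = j + 1 then (1 : ℤ) else 0) - (if i = j then 1 else 0) =
      (if i - 1 = j then 1 else 0) - (if i = j then 1 else 0) := by
    simp only [sub_eq_iff_eq_add (c := j)]
  cases a with
  | fwdRow i => rw [crossing_fwdRow, crossing_fwdRow, row, tail, head]
  | revRow i =>
    rw [crossing_revRow, crossing_revRow, tail, head]
    linarith [row i]
  | fwdShort i =>
    rw [crossing_fwdShort, crossing_fwdShort, short, tail, head]
  | revShort i =>
    have h := short i
    rw [crossing_revShort, crossing_revShort, tail, head]
    linarith

theorem Arc.sum_crossing [NeZero n] (ℓ : Fin m → ZMod n) (k : Fin m → ℕ) (hk : ∀ i, k i ≤ n)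
    (a : Arc m n) : ∑ j, a.crossing ℓ k j = a.len k := by
  have row (i : Fin m) :
      ∑ j, (if inInterval (ℓ i) (k i) j then (1 : ℤ) else 0) = k i := by
    simp_rw [ite_inInterval_eq_sum _ (hk i)]
    rw [Finset.sum_comm]
    simp
  cases a with
  | fwdRow i => simp only [crossing_fwdRow, row, len]
  | revRow i => simp only [crossing_revRow, Finset.sum_neg_distrib, row, len]
  | fwdShort i => simp [crossing_fwdShort, len]
  | revShort i => simp [crossing_revShort, len]

theorem sum_sum_crossing [NeZero n] (ℓ : Fin m → ZMod n) (k : Fin m → ℕ) (hk : ∀ i, k i ≤ n)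
    (γ : List (Arc m n)) : ∑ j, (γ.map (Arc.crossing ℓ k j)).sum = windingSum k γ := by
  induction γ with
  | nil => simp [windingSum]
  | cons a γ ih =>
    rw [windingSum] at ih ⊢
    simp only [List.map_cons, List.sum_cons, Finset.sum_add_distrib, Arc.sum_crossing ℓ k hk, ih]

theorem map_head_of_isChain (ℓ : Fin m → ZMod n) (k : Fin m → ℕ) (a : Arc m n)
    (γ : List (Arc m n))
    (h : List.IsChain (fun a b => Arc.head ℓ k a = Arc.tail ℓ k b) (a :: γ)) :
    (a :: γ).map (Arc.head ℓ k) =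
      γ.map (Arc.tail ℓ k) ++ [Arc.head ℓ k ((a :: γ).getLast (List.cons_ne_nil a γ))] := by
  induction γ generalizing a with
  | nil => simp
  | cons b γ ih =>
    rw [List.isChain_cons_cons] at h
    rw [List.map_cons, ih b h.2, h.1]
    simp

/-- The heads of a closed walk are its tails, rotated by one. -/
theorem IsClosedWalk.map_head {ℓ : Fin m → ZMod n} {k : Fin m → ℕ} {γ : List (Arc m n)}
    (h : IsClosedWalk ℓ k γ) :
    γ.map (Arc.head ℓ k) = (γ.map (Arc.tail ℓ k)).rotate 1 := by
  obtain ⟨hne, hc, hl⟩ := h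
  cases γ with
  | nil => exact absurd rfl hne
  | cons a γ =>
    rw [map_head_of_isChain ℓ k a γ hc, hl]
    simp

theorem pPlus_sub_pMinus (ℓ : Fin m → ZMod n) (k : Fin m → ℕ) (γ : List (Arc m n))
    (j : ZMod n) :
    (pPlus ℓ k γ j : ℤ) - pMinus ℓ k γ j = (γ.map (Arc.crossing ℓ k j)).sum := by
  induction γ with
  | nil => simp [pPlus, pMinus]
  | cons a γ ih =>
    rw [List.map_cons, List.sum_cons, ← ih]
    simp only [pPlus, pMinus, List.countP_cons, Arc.crossing, decide_eq_true_eq]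
    by_cases h1 : a.IsForward <;> by_cases h2 : a.Jumps ℓ k j <;> simp [h1, h2] <;> ring

/-- The net flow of a closed walk across every cut equals its winding number. -/
theorem IsClosedWalk.pPlus_sub_pMinus_eq [NeZero n] {ℓ : Fin m → ZMod n} {k : Fin m → ℕ}
    (hk : ∀ i, k i ≤ n) {γ : List (Arc m n)} (h : IsClosedWalk ℓ k γ) {p : ℤ}
    (hp : p * (n : ℤ) = windingSum k γ) (j : ZMod n) :
    (pPlus ℓ k γ j : ℤ) - pMinus ℓ k γ j = p := by
  rw [pPlus_sub_pMinus]
  set f : ZMod n → ℤ := fun j => (γ.map (Arc.crossing ℓ k j)).sum with hf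
  have count_map (g : Arc m n → ZMod n) (i : ZMod n) :
      (γ.map fun a => if g a = i then (1 : ℤ) else 0).sum = ((γ.map g).count i : ℤ) := by
    clear hf hp h
    induction γ with
    | nil => simp
    | cons a γ ih =>
      rw [List.map_cons, List.sum_cons, ih, List.map_cons, List.count_cons]
      by_cases e : g a = i <;> simp [e, add_comm]
  have hstep (i : ZMod n) : f (i + 1) = f i := by
    have hadd : (γ.map fun a => a.crossing ℓ k (i + 1) + if a.head ℓ k = i then 1 else 0).sum =
        (γ.map fun a => a.crossing ℓ k i + if a.tail ℓ k = i then 1 else 0).sum := by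
      congr 1
      refine List.map_congr_left fun a _ => ?_
      linarith [Arc.crossing_add_one_sub ℓ k hk i a]
    rw [List.sum_map_add, List.sum_map_add, count_map, count_map, h.map_head,
      (List.rotate_perm _ 1).count_eq] at hadd
    exact add_right_cancel hadd
  have hconst (t : ℕ) : f (t : ZMod n) = f 0 := by
    induction t with
    | zero => simp
    | succ t ih => rw [Nat.cast_succ, hstep, ih]
  have hall (i : ZMod n) : f i = f 0 := by
    rw [← ZMod.natCast_zmod_val i, hconst]
  have hsum : ∑ i, f i = windingSum k γ :=
    sum_sum_crossing ℓ k hk γ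
  rw [Finset.sum_congr rfl fun i _ => hall i] at hsum
  simp only [Finset.sum_const, Finset.card_univ, ZMod.card, nsmul_eq_mul] at hsum
  have hn : (n : ℤ) ≠ 0 := by exact_mod_cast NeZero.ne n
  have : f j = p := by
    rw [hall j]
    exact mul_right_cancel₀ hn (by rw [hp, ← hsum, mul_comm])
  exact this

theorem IsCircuit.nodup {ℓ : Fin m → ZMod n} {k : Fin m → ℕ} {γ : List (Arc m n)}
    (h : IsCircuit ℓ k γ) : γ.Nodup :=
  List.Nodup.of_map _ h.2

/-- A circuit traversing a short arc in both directions has winding number zero. -/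
theorem IsCircuit.windingSum_eq_zero {ℓ : Fin m → ZMod n} {k : Fin m → ℕ} {γ : List (Arc m n)}
    (h : IsCircuit ℓ k γ) {j : ZMod n} (hf : Arc.fwdShort j ∈ γ) (hr : Arc.revShort j ∈ γ) :
    windingSum k γ = 0 := by
  have hpos : 0 < γ.length := List.length_pos_of_mem hf
  have hnext (i : ℕ) (hi : i < γ.length) :
      Arc.head ℓ k γ[i] = Arc.tail ℓ k (γ[(i + 1) % γ.length]'(Nat.mod_lt _ hpos)) := by
    have h1 := List.getElem_of_eq h.1.map_head (i := i) (by simpa using hi)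
    rw [List.getElem_rotate] at h1
    simpa using h1
  have hinj {a b : Arc m n} (ha : a ∈ γ) (hb : b ∈ γ) (e : a.tail ℓ k = b.tail ℓ k) : a = b :=
    List.inj_on_of_nodup_map h.2 ha hb e
  obtain ⟨i, hi, hif⟩ := List.getElem_of_mem hf
  have h1 := hinj (List.getElem_mem (Nat.mod_lt (i + 1) hpos)) hr
    (by rw [← hnext i hi, hif]; rfl)
  have h2 := hinj (List.getElem_mem (Nat.mod_lt ((i + 1) % γ.length + 1) hpos)) hf
    (by rw [← hnext _ (Nat.mod_lt _ hpos), h1]; rfl)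
  have h3 := (h.nodup.getElem_inj_iff).1 (h2.trans hif.symm)
  have hlen : γ.length ≤ 2 := by
    rw [Nat.mod_add_mod, add_assoc] at h3
    have : i + 2 ≡ i + 0 [MOD γ.length] := by
      rw [Nat.ModEq, h3, add_zero, Nat.mod_eq_of_lt hi]
    exact Nat.le_of_dvd two_pos ((Nat.modEq_zero_iff_dvd).1 (Nat.ModEq.add_left_cancel' i this))
  have hsub : List.Subperm [Arc.fwdShort j, Arc.revShort j] γ := by
    refine List.Nodup.subperm (by simp) ?_
    intro a ha
    simp only [List.mem_cons, List.not_mem_nil, or_false] at ha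
    rcases ha with rfl | rfl <;> assumption
  have hperm := hsub.perm_of_length_le (by simpa using hlen)
  rw [windingSum, ← (hperm.map _).sum_eq]
  simp [Arc.len]

theorem countP_fwdRow_eq_card {γ : List (Arc m n)} (hγ : γ.Nodup) (P : Fin m → Prop) :
    γ.countP (fun a => decide (∃ i, a = Arc.fwdRow i ∧ P i)) =
      ((Finset.univ.filter fun i : Fin m => Arc.fwdRow i ∈ γ).filter P).card := by
  rw [List.countP_eq_length_filter, ← List.toFinset_card_of_nodup (hγ.filter _),
    ← Finset.card_image_of_injective (f := (Arc.fwdRow : Fin m → Arc m n)) _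
      (fun _ _ h => Arc.fwdRow.inj h)]
  congr 1
  ext a
  simp only [List.mem_toFinset, List.mem_filter, decide_eq_true_eq, Finset.mem_image,
    Finset.mem_filter, Finset.mem_univ, true_and]
  constructor
  · rintro ⟨h, i, rfl, hi⟩
    exact ⟨i, ⟨h, hi⟩, rfl⟩
  · rintro ⟨i, ⟨h, hi⟩, rfl⟩
    exact ⟨h, i, rfl, hi⟩

theorem numRowArcs_eq_card {γ : List (Arc m n)} (hγ : γ.Nodup) :
    numRowArcs γ = (Finset.univ.filter fun i : Fin m => Arc.fwdRow i ∈ γ).card := by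
  have h := countP_fwdRow_eq_card hγ fun _ => True
  rw [Finset.filter_true] at h
  rw [← h, numRowArcs]
  refine List.countP_congr fun a _ => ?_
  cases a <;> simp

theorem pMinus_eq_ite {ℓ : Fin m → ZMod n} {k : Fin m → ℕ} {γ : List (Arc m n)}
    (hγ : γ.Nodup) (hrev : ∀ a ∈ γ, ¬ Arc.IsRevRow a) (j : ZMod n) :
    pMinus ℓ k γ j = if Arc.revShort j ∈ γ then 1 else 0 := by
  rw [← hγ.count, pMinus, List.count]
  refine List.countP_congr fun a ha => ?_
  have := hrev a ha
  cases a <;> simp_all [Arc.IsForward, Arc.Jumps, Arc.IsRevRow]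

theorem pPlus_eq_rowCount_add {ℓ : Fin m → ZMod n} {k : Fin m → ℕ} {γ : List (Arc m n)}
    (hγ : γ.Nodup) (j : ZMod n) :
    pPlus ℓ k γ j = rowCount ℓ k (Finset.univ.filter fun i : Fin m => Arc.fwdRow i ∈ γ) j +
      if Arc.fwdShort j ∈ γ then 1 else 0 := by
  rw [← hγ.count, rowCount, ← countP_fwdRow_eq_card hγ, pPlus, List.count]
  clear hγ
  induction γ with
  | nil => simp
  | cons a γ ih =>
    simp only [List.countP_cons, ih]
    cases a <;> simp [Arc.IsForward, Arc.Jumps] <;> omega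

theorem tVal_const (α : ℤ) {γ : List (Arc m n)} (hrev : ∀ a ∈ γ, ¬ Arc.IsRevRow a) :
    tVal (fun _ => α) γ = α * numRowArcs γ := by
  induction γ with
  | nil => simp [tVal, numRowArcs]
  | cons a γ ih =>
    have h := ih fun b hb => hrev b (List.mem_cons_of_mem a hb)
    have ha := hrev a List.mem_cons_self
    simp only [tVal, numRowArcs, List.map_cons, List.sum_cons, List.countP_cons] at h ⊢
    rw [h]
    cases a <;> simp_all [Arc.IsRevRow]
    ring

theorem tMinusVal_eq_zero (b : Fin m → ℤ) {γ : List (Arc m n)}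
    (hrev : ∀ a ∈ γ, ¬ Arc.IsRevRow a) : tMinusVal b γ = 0 := by
  refine List.sum_eq_zero fun c hc => ?_
  obtain ⟨a, ha, rfl⟩ := List.mem_map.1 hc
  have := hrev a ha
  cases a <;> simp_all [Arc.IsRevRow]

theorem fdiv_add_sub_one_of_not_dvd {t p : ℤ} (hp : 0 < p) (h : ¬ p ∣ t) :
    Int.fdiv (t + p - 1) p = Int.fdiv t p + 1 := by
  rw [Int.fdiv_eq_ediv_of_nonneg _ hp.le, Int.fdiv_eq_ediv_of_nonneg _ hp.le]
  have h0 : t % p ≠ 0 := fun e => h (Int.dvd_of_emod_eq_zero e)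
  have h1 := Int.emod_nonneg t hp.ne'
  have h2 := Int.emod_lt_of_pos t hp
  have h3 := Int.emod_add_mul_ediv t p
  have : t + p - 1 = (t % p - 1) + (t / p + 1) * p := by linarith
  rw [this, Int.add_mul_ediv_right _ _ hp.ne', Int.ediv_eq_zero_of_lt (by omega) (by omega),
    zero_add]

end Circuits

/-- For a circuit `Γ` in `F(A)` with `s` row arcs and winding number
`p`, with `2 ≤ p ≤ αs - 1` and `p ∤ αs`, and `r := αs - p⌊αs/p⌋`, the `Γ`-inequality of
`Q*(A, α·1)` takes the form `r ∑_{j ∉ ⊗(Γ)} x_j + (r+1) ∑_{j ∈ ⊗(Γ)} x_j ≥ r ⌈αs/p⌉`.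
Moreover, if `α = 1` and `⊗(Γ) ≠ ∅`, the `Γ`-inequality equals the row family inequality
induced by `F = {i : aᵢ is a row arc of Γ}`. -/
theorem gammaIneq_form_homogeneous {m n : ℕ} [NeZero n] (ℓ : Fin m → ZMod n)
    (k : Fin m → ℕ) (hA : circBounds n k)
    (hdom : NoDominatingRows (circMatrix ℓ k)) (α : ℕ)
    (γ : List (Arc m n)) (hγ : IsCircuit ℓ k γ) (hnorev : ∀ a ∈ γ, ¬ Arc.IsRevRow a)
    (s : ℕ) (hs : numRowArcs γ = s)
    (p : ℤ) (hp : p * (n : ℤ) = windingSum k γ)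
    (hp2 : 2 ≤ p) (hps : p ≤ (α : ℤ) * s - 1) (hnd : ¬ (p ∣ (α : ℤ) * s))
    (r : ℤ) (hr : r = (α : ℤ) * s - p * Int.fdiv ((α : ℤ) * s) p) :
    (∀ x : ZMod n → ℝ,
      GammaIneqHolds ℓ k (fun _ => (α : ℤ)) γ p x ↔
        (r : ℝ) * (∑ j ∈ Finset.univ.filter (fun j : ZMod n => Arc.revShort j ∉ γ), x j) +
            ((r : ℝ) + 1) *
              (∑ j ∈ Finset.univ.filter (fun j : ZMod n => Arc.revShort j ∈ γ), x j) ≥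
          (r : ℝ) * ((Int.fdiv ((α : ℤ) * s + p - 1) p : ℤ) : ℝ)) ∧
    (α = 1 → (∃ j : ZMod n, Arc.revShort j ∈ γ) →
      ∀ x : ZMod n → ℝ,
        GammaIneqHolds ℓ k (fun _ => (α : ℤ)) γ p x ↔
          RowFamilyIneqHolds ℓ k
            (Finset.univ.filter fun i : Fin m => Arc.fwdRow i ∈ γ) x) := by
  have hnodup := hγ.nodup
  have ht : tVal (fun _ => (α : ℤ)) γ = (α : ℤ) * s := by rw [tVal_const _ hnorev, hs]
  have hp0 : 0 < p := by omega
  have hceil := fdiv_add_sub_one_of_not_dvd hp0 hnd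
  have hβ : betaVal (fun _ => (α : ℤ)) γ p = Int.fdiv ((α : ℤ) * s) p := by rw [betaVal, ht]
  have hrv : rVal (fun _ => (α : ℤ)) γ p = r := by rw [rVal, hβ, ht, hr, mul_comm p]
  have hform (x : ZMod n → ℝ) : GammaIneqHolds ℓ k (fun _ => (α : ℤ)) γ p x ↔
      (r : ℝ) * (∑ j ∈ Finset.univ.filter (fun j : ZMod n => Arc.revShort j ∉ γ), x j) +
          ((r : ℝ) + 1) *
            (∑ j ∈ Finset.univ.filter (fun j : ZMod n => Arc.revShort j ∈ γ), x j) ≥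
        (r : ℝ) * ((Int.fdiv ((α : ℤ) * s + p - 1) p : ℤ) : ℝ) := by
    have hsum : ∑ j : ZMod n, ((pMinus ℓ k γ j : ℝ) + (r : ℝ)) * x j =
        (r : ℝ) * (∑ j ∈ Finset.univ.filter (fun j : ZMod n => Arc.revShort j ∉ γ), x j) +
          ((r : ℝ) + 1) *
            (∑ j ∈ Finset.univ.filter (fun j : ZMod n => Arc.revShort j ∈ γ), x j) := by
      rw [← Finset.sum_filter_add_sum_filter_not _ (fun j : ZMod n => Arc.revShort j ∈ γ),
        Finset.mul_sum, Finset.mul_sum, add_comm]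
      congr 1
      · refine Finset.sum_congr rfl fun j hj => ?_
        rw [pMinus_eq_ite hnodup hnorev, if_neg (Finset.mem_filter.1 hj).2]
        simp
      · refine Finset.sum_congr rfl fun j hj => ?_
        rw [pMinus_eq_ite hnodup hnorev, if_pos (Finset.mem_filter.1 hj).2]
        push_cast
        ring
    rw [GammaIneqHolds, hrv, hβ, tMinusVal_eq_zero _ hnorev, hceil, hsum]
    push_cast
    rw [add_zero]
  refine ⟨hform, ?_⟩
  rintro rfl ⟨j₀, hj₀⟩ x
  rw [hform x]
  obtain ⟨q, rfl⟩ := Int.eq_ofNat_of_zero_le hp0.le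
  set F : Finset (Fin m) := Finset.univ.filter fun i : Fin m => Arc.fwdRow i ∈ γ with hF
  have hn : (0 : ℤ) < n := by exact_mod_cast NeZero.pos n
  have hcount (j : ZMod n) :
      rowCount ℓ k F j + (if Arc.fwdShort j ∈ γ then 1 else 0) =
        q + if Arc.revShort j ∈ γ then 1 else 0 := by
    have h := hγ.1.pPlus_sub_pMinus_eq (fun i => (hA i).2.trans (Nat.sub_le n 1)) hp j
    rw [pPlus_eq_rowCount_add hnodup, pMinus_eq_ite hnodup hnorev, ← hF] at h
    omega
  have hexcl (j : ZMod n) (hj : Arc.revShort j ∈ γ) : Arc.fwdShort j ∉ γ := by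
    intro hj'
    have := hγ.windingSum_eq_zero hj' hj
    rw [this] at hp
    exact (mul_pos hp0 hn).ne' hp
  have hpos (j : ZMod n) (hj : Arc.revShort j ∈ γ) : rowCount ℓ k F j = q + 1 := by
    have h := hcount j
    rwa [if_pos hj, if_neg (hexcl j hj)] at h
  have hneg (j : ZMod n) (hj : Arc.revShort j ∉ γ) : rowCount ℓ k F j ≤ q := by
    have h := hcount j
    rw [if_neg hj] at h
    omega
  have hsup : (Finset.univ.sup fun j : ZMod n => rowCount ℓ k F j) = q + 1 := by
    refine le_antisymm (Finset.sup_le fun j _ => ?_) ?_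
    · by_cases hj : Arc.revShort j ∈ γ
      · exact (hpos j hj).le
      · exact (hneg j hj).trans (Nat.le_succ q)
    · rw [← hpos j₀ hj₀]
      exact Finset.le_sup (f := fun j : ZMod n => rowCount ℓ k F j) (Finset.mem_univ j₀)
  have hcard : F.card = s := by rw [← hs, numRowArcs_eq_card hnodup]
  have hO : (Finset.univ.filter fun j : ZMod n => rowCount ℓ k F j = q + 1) =
      Finset.univ.filter fun j : ZMod n => Arc.revShort j ∈ γ := by
    refine Finset.filter_congr fun j _ => ⟨fun h => ?_, hpos j⟩
    by_contra hj
    have := hneg j hj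
    omega
  have hI : (Finset.univ.filter fun j : ZMod n => rowCount ℓ k F j ≤ q) =
      Finset.univ.filter fun j : ZMod n => Arc.revShort j ∉ γ := by
    refine Finset.filter_congr fun j _ => ⟨fun h hj => ?_, hneg j⟩
    have := hpos j hj
    omega
  have hrs : ((s - q * (s / q) : ℕ) : ℝ) = (r : ℝ) := by
    have : ((s - q * (s / q) : ℕ) : ℤ) = r := by
      rw [hr, Int.fdiv_eq_ediv_of_nonneg _ hp0.le, Nat.cast_sub (Nat.mul_div_le s q)]
      push_cast
      ring_nf
    exact_mod_cast this
  have hcs : (((s + q - 1) / q : ℕ) : ℝ) =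
      ((Int.fdiv (((1 : ℕ) : ℤ) * s + (q : ℤ) - 1) q : ℤ) : ℝ) := by
    have : (((s + q - 1) / q : ℕ) : ℤ) = Int.fdiv (((1 : ℕ) : ℤ) * s + (q : ℤ) - 1) q := by
      rw [Int.fdiv_eq_ediv_of_nonneg _ hp0.le, Int.natCast_ediv]
      congr 1
      omega
    rw [← this, Int.cast_natCast]
  simp only [RowFamilyIneqHolds, hsup, hcard, Nat.add_sub_cancel, hO, hI, hrs, hcs]
  rw [add_comm]

end CircCover
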